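/- Let γ > 0, c := coth γ, and φ_γ(x) := (cosh γ · cos x − 1)/(sinh γ · (cosh γ − cos x)). Then ∫_{-π}^{π} φ_γ(x)³ dx = −π·(c − 1)²·(2c + 1); in particular this integral is negative. -/

import Mathlib

open MeasureTheory

/-- The 2π-periodic Benjamin–Ono travelling wave profile with parameter `γ`. -/
noncomputable def boWave (γ : ℝ) (x : ℝ) : ℝ :=
  (Real.cosh γ * Real.cos x - 1) / (Real.sinh γ * (Real.cosh γ - Real.cos x))

theorem cosh_sub_cos_pos {γ : ℝ} (hγ : 0 < γ) (x : ℝ) : 0 < Real.cosh γ - Real.cos x := by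
  have h1 := Real.one_lt_cosh.mpr hγ.ne'
  linarith [Real.cos_le_one x]

/-- An antiderivative of the Poisson kernel that is continuous on the whole line. -/
theorem hasDerivAt_poisson_primitive {γ : ℝ} (hγ : 0 < γ) (x : ℝ) :
    HasDerivAt (fun x => x + 2 * Real.arctan
        (Real.exp (-γ) * Real.sin x / (1 - Real.exp (-γ) * Real.cos x)))
      (Real.sinh γ / (Real.cosh γ - Real.cos x)) x := by
  have hD := cosh_sub_cos_pos hγ x
  rw [Real.cosh_eq] at hD
  rw [Real.sinh_eq, Real.cosh_eq]
  have hp : Real.exp γ = (Real.exp (-γ))⁻¹ := by rw [Real.exp_neg, inv_inv]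
  have hq1 : Real.exp (-γ) < 1 := Real.exp_lt_one_iff.mpr (neg_lt_zero.mpr hγ)
  have hq0 := Real.exp_pos (-γ)
  rw [hp] at hD ⊢
  generalize Real.exp (-γ) = q at *
  have hB : 0 < 1 - q * Real.cos x := by nlinarith [Real.cos_le_one x]
  have hsc := Real.sin_sq_add_cos_sq x
  have hE : 0 < (1 - q * Real.cos x) ^ 2 + (q * Real.sin x) ^ 2 := by positivity
  have hD_eq : (q⁻¹ + q) / 2 - Real.cos x
      = ((1 - q * Real.cos x) ^ 2 + (q * Real.sin x) ^ 2) / (2 * q) := by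
    field_simp
    linear_combination -q ^ 2 * hsc
  have h := (hasDerivAt_id x).add (((((Real.hasDerivAt_sin x).const_mul q).div
    (((Real.hasDerivAt_cos x).const_mul q).const_sub 1) hB.ne').arctan).const_mul 2)
  refine h.congr_deriv ?_
  have hA : 1 + (q * Real.sin x / (1 - q * Real.cos x)) ^ 2
      = ((1 - q * Real.cos x) ^ 2 + (q * Real.sin x) ^ 2) / (1 - q * Real.cos x) ^ 2 := by
    field_simp
  simp only [Pi.div_apply]
  rw [hD_eq, hA]
  field_simp
  linear_combination -q ^ 2 * hsc

theorem hasDerivAt_sin_div_cosh_sub_cos {γ : ℝ} (hγ : 0 < γ) (x : ℝ) :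
    HasDerivAt (fun x => Real.sin x / (Real.cosh γ - Real.cos x))
      ((Real.cosh γ * Real.cos x - 1) / (Real.cosh γ - Real.cos x) ^ 2) x := by
  have hD := cosh_sub_cos_pos hγ x
  refine ((Real.hasDerivAt_sin x).div ((Real.hasDerivAt_cos x).const_sub _) hD.ne').congr_deriv ?_
  congr 1
  linear_combination -Real.sin_sq_add_cos_sq x

theorem hasDerivAt_sin_div_cosh_sub_cos_sq {γ : ℝ} (hγ : 0 < γ) (x : ℝ) :
    HasDerivAt (fun x => Real.sin x / (Real.cosh γ - Real.cos x) ^ 2)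
      ((Real.cos x * (Real.cosh γ - Real.cos x) - 2 * (1 - Real.cos x ^ 2))
        / (Real.cosh γ - Real.cos x) ^ 3) x := by
  have hD := cosh_sub_cos_pos hγ x
  refine ((Real.hasDerivAt_sin x).div (((Real.hasDerivAt_cos x).const_sub _).pow 2)
    (pow_pos hD 2).ne').congr_deriv ?_
  simp only [Pi.pow_apply]
  field_simp
  push_cast
  linear_combination -2 * (Real.cosh γ - Real.cos x) * Real.sin_sq_add_cos_sq x

theorem continuous_boWave {γ : ℝ} (hγ : 0 < γ) : Continuous (boWave γ) := by
  unfold boWave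
  refine Continuous.div (by fun_prop) (by fun_prop) fun x => ?_
  exact (mul_pos (Real.sinh_pos_iff.mpr hγ) (cosh_sub_cos_pos hγ x)).ne'

theorem integral_boWave_cube {γ : ℝ} (hγ : 0 < γ) :
    (∫ x in (-Real.pi)..Real.pi, (boWave γ x) ^ 3)
      = -Real.pi * (Real.cosh γ / Real.sinh γ - 1) ^ 2
          * (2 * (Real.cosh γ / Real.sinh γ) + 1) := by
  have hS : 0 < Real.sinh γ := Real.sinh_pos_iff.mpr hγ
  have hCS := Real.cosh_sq γ
  set c := Real.cosh γ / Real.sinh γ with hc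
  have hderiv : ∀ x ∈ Set.uIcc (-Real.pi) Real.pi, HasDerivAt (fun x =>
      Real.sinh γ / 2 * (Real.sin x / (Real.cosh γ - Real.cos x) ^ 2)
      - 3 * c / 2 * (Real.sin x / (Real.cosh γ - Real.cos x))
      + (3 * c ^ 2 - 1) / 2 * (x + 2 * Real.arctan
        (Real.exp (-γ) * Real.sin x / (1 - Real.exp (-γ) * Real.cos x)))
      - c ^ 3 * x) (boWave γ x ^ 3) x := by
    intro x _
    have hD := cosh_sub_cos_pos hγ x
    refine (((((hasDerivAt_sin_div_cosh_sub_cos_sq hγ x).const_mul _).sub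
      ((hasDerivAt_sin_div_cosh_sub_cos hγ x).const_mul _)).add
      ((hasDerivAt_poisson_primitive hγ x).const_mul _)).sub
      ((hasDerivAt_id x).const_mul _)).congr_deriv ?_
    have hφ : boWave γ x = Real.sinh γ / (Real.cosh γ - Real.cos x) - c := by
      rw [boWave, hc]
      field_simp
      linear_combination hCS
    have h1 : (Real.cosh γ * Real.cos x - 1) / (Real.cosh γ - Real.cos x) ^ 2
        = (Real.sinh γ / (Real.cosh γ - Real.cos x)) ^ 2
          - c * (Real.sinh γ / (Real.cosh γ - Real.cos x)) := by
      rw [hc]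
      field_simp
      linear_combination hCS
    have h2 : Real.sinh γ / 2 * ((Real.cos x * (Real.cosh γ - Real.cos x)
          - 2 * (1 - Real.cos x ^ 2)) / (Real.cosh γ - Real.cos x) ^ 3)
        = (Real.sinh γ / (Real.cosh γ - Real.cos x)) ^ 3
          - 3 * c / 2 * (Real.sinh γ / (Real.cosh γ - Real.cos x)) ^ 2
          + Real.sinh γ / (Real.cosh γ - Real.cos x) / 2 := by
      rw [hc]
      field_simp
      linear_combination 2 * hCS
    rw [hφ, h1, h2]
    ring
  rw [intervalIntegral.integral_eq_sub_of_hasDerivAt hderiv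
    (((continuous_boWave hγ).pow 3).intervalIntegrable _ _)]
  simp only [Real.sin_neg, Real.sin_pi, neg_zero, mul_zero, zero_div, Real.arctan_zero]
  ring

theorem stmt12 (γ : ℝ) (hγ : 0 < γ) :
    (∫ x in (-Real.pi)..Real.pi, (boWave γ x) ^ 3)
      = -Real.pi * (Real.cosh γ / Real.sinh γ - 1) ^ 2
          * (2 * (Real.cosh γ / Real.sinh γ) + 1) ∧
    (∫ x in (-Real.pi)..Real.pi, (boWave γ x) ^ 3) < 0 := by
  refine ⟨integral_boWave_cube hγ, ?_⟩
  rw [integral_boWave_cube hγ, neg_mul, neg_mul, neg_lt_zero]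
  have hS : 0 < Real.sinh γ := Real.sinh_pos_iff.mpr hγ
  have hc : 1 < Real.cosh γ / Real.sinh γ := (one_lt_div hS).mpr (Real.sinh_lt_cosh γ)
  have hc' : 0 < Real.cosh γ / Real.sinh γ - 1 := sub_pos.mpr hc
  have := Real.pi_pos
  positivity
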